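/- arXiv:0906.3374 — 3 statements merged into one kernel-verified Lean document; each statement's English description precedes it below -/
import Mathlib

section
/- Let N and H be residually finite groups with N finitely generated, and let φ : H → Aut(N) be an action of H on N by automorphisms. Then the semidirect product N ⋊_φ H is residually finite. -/
/-- A witness that the element `g ≠ 1` is detected by a finite quotient: a homomorphism from
`G` onto a finite group sending `g` to a nontrivial element. -/
structure FiniteQuotientWitness (G : Type*) [Group G] (g : G) where
  Q : Type
  [grp : Group Q]
  [fin : Finite Q]
  f : G →* Q
  surjective : Function.Surjective f
  ne_one : f g ≠ 1

/-- A group is residually finite if for every nontrivial element `g` there is a homomorphism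
onto a finite group sending `g` to a nontrivial element. -/
def IsResiduallyFinite (G : Type*) [Group G] : Prop :=
  ∀ g : G, g ≠ 1 → Nonempty (FiniteQuotientWitness G g)

/-- A homomorphism to a finite group (in any universe, not necessarily surjective) that does not
kill `g` yields a finite quotient detecting `g`. -/
theorem FiniteQuotientWitness.nonempty_of_hom {G P : Type*} [Group G] [Group P] [Finite P]
    (f : G →* P) {g : G} (hg : f g ≠ 1) : Nonempty (FiniteQuotientWitness G g) := by
  let e : Shrink.{0} f.range ≃* f.range := Shrink.mulEquiv
  have : Finite (Shrink.{0} f.range) := Finite.of_equiv _ e.symm.toEquiv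
  refine ⟨⟨Shrink.{0} f.range, e.symm.toMonoidHom.comp f.rangeRestrict,
    e.symm.surjective.comp f.rangeRestrict_surjective, fun h => hg ?_⟩⟩
  have h' : f.rangeRestrict g = 1 := e.symm.map_eq_one_iff.mp h
  exact congrArg Subtype.val h'

/-- There are only finitely many homomorphisms from a finitely generated group to a finite
group. -/
theorem Group.FG.finite_monoidHom {N Q : Type*} [Group N] [Group Q] [Finite Q]
    (hN : Group.FG N) : Finite (N →* Q) := by
  obtain ⟨S, hS⟩ := Group.fg_def.mp hN
  refine Finite.of_injective (fun (f : N →* Q) (s : S) => f s) fun f g hfg => ?_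
  exact MonoidHom.eq_of_eqOn_dense hS fun s hs => congrFun hfg ⟨s, hs⟩

/-- The semidirect product `N ⋊[φ] H` acts on `(N →* Q) × Q`: the factor `H` acts by
precomposition on homomorphisms, and `n : N` sends `(f, q)` to `(f, f n * q)`. -/
@[reducible]
def SemidirectProduct.homProdAction {N H : Type*} [Group N] [Group H] (φ : H →* MulAut N)
    (Q : Type*) [Group Q] : MulAction (N ⋊[φ] H) ((N →* Q) × Q) where
  smul x p := (p.1.comp (φ x.right⁻¹).toMonoidHom, p.1 (φ x.right⁻¹ x.left) * p.2)
  one_smul p := by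
    change (p.1.comp (φ 1⁻¹).toMonoidHom, p.1 (φ 1⁻¹ 1) * p.2) = p
    ext <;> simp
  mul_smul x y p := by
    change (p.1.comp (φ (x * y).right⁻¹).toMonoidHom,
        p.1 (φ (x * y).right⁻¹ (x * y).left) * p.2) =
      ((p.1.comp (φ y.right⁻¹).toMonoidHom).comp (φ x.right⁻¹).toMonoidHom,
        (p.1.comp (φ y.right⁻¹).toMonoidHom) (φ x.right⁻¹ x.left) *
          (p.1 (φ y.right⁻¹ y.left) * p.2))
    ext <;> simp [mul_assoc]

/-- If `N` and `H` are residually finite groups with `N` finitely generated,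
and `φ : H → Aut(N)` is an action of `H` on `N` by automorphisms, then the semidirect product
`N ⋊[φ] H` is residually finite. -/
theorem stmt9 (N H : Type*) [Group N] [Group H] (φ : H →* MulAut N)
    (hN : IsResiduallyFinite N) (hH : IsResiduallyFinite H) (hNfg : Group.FG N) :
    IsResiduallyFinite (N ⋊[φ] H) := by
  intro g hg
  by_cases hr : g.right = 1
  · have hl : g.left ≠ 1 := fun hl => hg (SemidirectProduct.ext hl hr)
    obtain ⟨⟨Q, f, -, hf⟩⟩ := hN g.left hl
    have : Finite (N →* Q) := hNfg.finite_monoidHom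
    let := SemidirectProduct.homProdAction φ Q
    refine FiniteQuotientWitness.nonempty_of_hom
      (MulAction.toPermHom (N ⋊[φ] H) ((N →* Q) × Q)) fun h => hf ?_
    have h₂ : f (φ g.right⁻¹ g.left) * 1 = 1 :=
      congrArg Prod.snd (DFunLike.congr_fun h (f, (1 : Q)))
    simpa [hr] using h₂
  · obtain ⟨⟨Q, f, -, hf⟩⟩ := hH g.right hr
    exact FiniteQuotientWitness.nonempty_of_hom (f.comp SemidirectProduct.rightHom) hf
end

section
/- Let G be a finitely generated group which is not residually finite, and suppose G has a finite normal subgroup Z such that G/Z is hereditary just infinite. Then G is finitely discriminable; more precisely, if x ∈ G \ {1} is an element contained in every finite-index subgroup of G (such x exists since G is not residually finite), then X = {x} ∪ (Z \ {1}) is a finite discriminating subset: every nontrivial normal subgroup N of G satisfies N ∩ X ≠ ∅. -/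
/-- A group `Q` is hereditary just infinite if `Q` is infinite and every proper quotient of
every finite-index subgroup of `Q` is finite. -/
def HereditaryJustInfinite (Q : Type*) [Group Q] : Prop :=
  Infinite Q ∧ ∀ H : Subgroup Q, H.index ≠ 0 →
    ∀ K : Subgroup H, K.Normal → K ≠ ⊥ → Finite (H ⧸ K)

/-- A group `G` is finitely discriminable if there is a finite subset `X` of `G \ {1}` meeting
every nontrivial normal subgroup of `G`. -/
def FinitelyDiscriminable (G : Type*) [Group G] : Prop :=
  ∃ X : Set G, X.Finite ∧ (1 : G) ∉ X ∧
    ∀ N : Subgroup G, N.Normal → N ≠ ⊥ → ∃ x ∈ X, x ∈ N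

theorem exists_ne_one_mem_of_finiteIndex {G : Type*} [Group G] (h : ¬ IsResiduallyFinite G) :
    ∃ x : G, x ≠ 1 ∧ ∀ H : Subgroup G, H.index ≠ 0 → x ∈ H := by
  unfold IsResiduallyFinite at h
  push Not at h
  obtain ⟨x, hx, hempty⟩ := h
  refine ⟨x, hx, fun H hH => ?_⟩
  by_contra hxH
  have : H.FiniteIndex := ⟨hH⟩
  let e : Shrink.{0} (G ⧸ H.normalCore) ≃* G ⧸ H.normalCore := Shrink.mulEquiv
  refine hempty.false
    { Q := Shrink.{0} (G ⧸ H.normalCore)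
      fin := Finite.of_equiv _ e.symm.toEquiv
      f := e.symm.toMonoidHom.comp (QuotientGroup.mk' H.normalCore)
      surjective := e.symm.surjective.comp (QuotientGroup.mk'_surjective _)
      ne_one := fun h1 => hxH ?_ }
  have h2 : QuotientGroup.mk' H.normalCore x = 1 := e.symm.map_eq_one_iff.mp h1
  exact H.normalCore_le ((QuotientGroup.eq_one_iff x).mp h2)

theorem HereditaryJustInfinite.index_ne_zero {Q : Type*} [Group Q]
    (hQ : HereditaryJustInfinite Q) {K : Subgroup Q} (hK : K.Normal) (hne : K ≠ ⊥) :
    K.index ≠ 0 := by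
  have hfin : Finite ((⊤ : Subgroup Q) ⧸ K.subgroupOf ⊤) := by
    refine hQ.2 ⊤ (by simp) _ inferInstance fun hbot => hne ?_
    simpa using Subgroup.subgroupOf_eq_bot.mp hbot
  rw [← Subgroup.relIndex_top_right]
  exact Subgroup.index_ne_zero_of_finite

/-- A normal subgroup not contained in a finite normal subgroup with hereditary just infinite
quotient has finite index. -/
theorem HereditaryJustInfinite.index_ne_zero_of_not_le {G : Type*} [Group G] {Z : Subgroup G}
    [Z.Normal] [Finite Z] (hG : HereditaryJustInfinite (G ⧸ Z)) {N : Subgroup G}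
    (hN : N.Normal) (hNZ : ¬ N ≤ Z) : N.index ≠ 0 := by
  have hmap : (N.map (QuotientGroup.mk' Z)).index ≠ 0 := by
    refine hG.index_ne_zero (hN.map _ (QuotientGroup.mk'_surjective Z)) fun hbot => hNZ ?_
    simpa using (Subgroup.map_eq_bot_iff N).mp hbot
  rw [Subgroup.index_map, QuotientGroup.ker_mk', QuotientGroup.range_mk', Subgroup.index_top,
    mul_one] at hmap
  rw [← Subgroup.relIndex_mul_index (le_sup_left : N ≤ N ⊔ Z), Subgroup.relIndex_sup_left]
  exact mul_ne_zero Subgroup.index_ne_zero_of_finite hmap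

/-- If `G` is finitely generated, not residually finite, and has a finite
normal subgroup `Z` with `G/Z` hereditary just infinite, then `G` is finitely discriminable;
more precisely, there is `x ≠ 1` lying in every finite-index subgroup of `G`, and for any such
`x` the set `X = {x} ∪ (Z \ {1})` is a finite discriminating subset. -/
theorem stmt13 (G : Type*) [Group G] (hfg : Group.FG G)
    (hnrf : ¬ IsResiduallyFinite G)
    (Z : Subgroup G) [Z.Normal] (hZfin : Finite Z)
    (hhji : HereditaryJustInfinite (G ⧸ Z)) :
    FinitelyDiscriminable G ∧
    (∃ x : G, x ≠ 1 ∧ ∀ H : Subgroup G, H.index ≠ 0 → x ∈ H) ∧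
    ∀ x : G, x ≠ 1 → (∀ H : Subgroup G, H.index ≠ 0 → x ∈ H) →
      ({x} ∪ ((Z : Set G) \ {1})).Finite ∧ (1 : G) ∉ {x} ∪ ((Z : Set G) \ {1}) ∧
      ∀ N : Subgroup G, N.Normal → N ≠ ⊥ →
        ∃ y ∈ {x} ∪ ((Z : Set G) \ {1}), y ∈ N := by
  have key : ∀ x : G, x ≠ 1 → (∀ H : Subgroup G, H.index ≠ 0 → x ∈ H) →
      ({x} ∪ ((Z : Set G) \ {1})).Finite ∧ (1 : G) ∉ {x} ∪ ((Z : Set G) \ {1}) ∧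
      ∀ N : Subgroup G, N.Normal → N ≠ ⊥ →
        ∃ y ∈ {x} ∪ ((Z : Set G) \ {1}), y ∈ N := by
    intro x hx hmem
    refine ⟨(Set.finite_singleton x).union ((Set.toFinite (Z : Set G)).sdiff), ?_, ?_⟩
    · simpa using hx.symm
    · intro N hN hne
      by_cases hNZ : N ≤ Z
      · obtain ⟨y, hyN, hy⟩ := N.bot_or_exists_ne_one.resolve_left hne
        exact ⟨y, Or.inr ⟨hNZ hyN, hy⟩, hyN⟩
      · exact ⟨x, Or.inl rfl, hmem N (hhji.index_ne_zero_of_not_le hN hNZ)⟩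
  obtain ⟨x, hx, hmem⟩ := exists_ne_one_mem_of_finiteIndex hnrf
  exact ⟨⟨_, key x hx hmem⟩, ⟨x, hx, hmem⟩, key⟩
end

section
/- Let G be a finitely presented group which is not residually finite, and suppose G has a finite normal subgroup Z such that G/Z is hereditary just infinite. Then G is isolated: for every finitely generated free group F, every normal subgroup N of F with F/N isomorphic to G, and every sequence (N_n) of normal subgroups of F converging to N (meaning: for every x ∈ N eventually x ∈ N_n, and for every y ∈ F \ N eventually y ∉ N_n), one has N_n = N for all sufficiently large n. -/
/-- A group `G` is finitely presented if it is isomorphic to the quotient of a finitely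
generated free group by the normal closure of a finite set. -/
def FinitelyPresentedGroup (G : Type*) [Group G] : Prop :=
  ∃ (n : ℕ) (S : Set (FreeGroup (Fin n))), S.Finite ∧
    Nonempty ((FreeGroup (Fin n) ⧸ Subgroup.normalClosure S) ≃* G)

/-- A finitely generated group `G` is isolated if for every finitely generated free group `F`,
every normal subgroup `N` of `F` with `F/N ≅ G`, and every sequence `(Nₙ)` of normal subgroups
of `F` converging to `N` (for every `x ∈ N` eventually `x ∈ Nₙ`, and for every `y ∉ N`
eventually `y ∉ Nₙ`), one has `Nₙ = N` for all sufficiently large `n`. -/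
def IsolatedGroup (G : Type*) [Group G] : Prop :=
  ∀ (k : ℕ) (N : Subgroup (FreeGroup (Fin k))) [N.Normal],
    Nonempty ((FreeGroup (Fin k) ⧸ N) ≃* G) →
    ∀ Nn : ℕ → Subgroup (FreeGroup (Fin k)), (∀ n, (Nn n).Normal) →
      (∀ x ∈ N, ∀ᶠ n in Filter.atTop, x ∈ Nn n) →
      (∀ y ∉ N, ∀ᶠ n in Filter.atTop, y ∉ Nn n) →
      ∀ᶠ n in Filter.atTop, Nn n = N

/-- A normal subgroup of finite index gives finite quotient witnesses for the elements outside it. -/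
theorem nonempty_finiteQuotientWitness {G : Type*} [Group G] (K : Subgroup G) [K.Normal]
    (hK : K.index ≠ 0) {g : G} (hg : g ∉ K) : Nonempty (FiniteQuotientWitness G g) := by
  have : K.FiniteIndex := ⟨hK⟩
  let e : Shrink.{0} (G ⧸ K) ≃* G ⧸ K := Shrink.mulEquiv
  have : Finite (Shrink.{0} (G ⧸ K)) := Finite.of_equiv _ e.symm.toEquiv
  exact ⟨{
    Q := Shrink.{0} (G ⧸ K)
    f := e.symm.toMonoidHom.comp (QuotientGroup.mk' K)
    surjective := e.symm.surjective.comp (QuotientGroup.mk'_surjective K)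
    ne_one := by simpa using hg }⟩

/-- If `Z` is a finite normal subgroup and every proper quotient of `G ⧸ Z` is finite, then every
normal subgroup of `G` not contained in `Z` has finite index. -/
theorem index_ne_zero_of_not_le {G : Type*} [Group G] (Z : Subgroup G) [Z.Normal] [Finite Z]
    (hZ : HereditaryJustInfinite (G ⧸ Z)) (K : Subgroup G) [hK : K.Normal] (hKZ : ¬ K ≤ Z) :
    K.index ≠ 0 := by
  have hmap : (K.map (QuotientGroup.mk' Z)).Normal :=
    hK.map _ (QuotientGroup.mk'_surjective Z)
  have hne : (K.map (QuotientGroup.mk' Z)).subgroupOf ⊤ ≠ ⊥ := by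
    intro h
    rw [Subgroup.subgroupOf_eq_bot, disjoint_top, Subgroup.map_eq_bot_iff,
      QuotientGroup.ker_mk'] at h
    exact hKZ h
  have := hZ.2 ⊤ (by simp) _ inferInstance hne
  have hidx : (K.map (QuotientGroup.mk' Z)).relIndex ⊤ ≠ 0 :=
    Subgroup.index_ne_zero_of_finite
  rw [Subgroup.relIndex_top_right, Subgroup.index_map, QuotientGroup.ker_mk'] at hidx
  replace hidx := left_ne_zero_of_mul hidx
  have hrel : K.relIndex (K ⊔ Z) ≠ 0 := by
    rw [Subgroup.relIndex_sup_left]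
    exact Subgroup.index_ne_zero_of_finite
  rw [← Subgroup.relIndex_mul_index (le_sup_left : K ≤ K ⊔ Z)]
  exact mul_ne_zero hrel hidx

theorem finitelyDiscriminable_of_not_isResiduallyFinite {G : Type*} [Group G]
    (hG : ¬ IsResiduallyFinite G) (Z : Subgroup G) [Z.Normal] [Finite Z]
    (hZ : HereditaryJustInfinite (G ⧸ Z)) : FinitelyDiscriminable G := by
  simp only [IsResiduallyFinite, not_forall] at hG
  obtain ⟨g, hg, hwit⟩ := hG
  refine ⟨insert g ((Z : Set G) \ {1}), ((Set.toFinite (Z : Set G)).sdiff).insert g,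
    by simp [hg.symm], fun K hK hne => ?_⟩
  by_cases hKZ : K ≤ Z
  · obtain ⟨x, hx, hx1⟩ := K.bot_or_exists_ne_one.resolve_left hne
    exact ⟨x, by simp [hKZ hx, hx1], hx⟩
  · refine ⟨g, by simp, ?_⟩
    by_contra hgK
    exact hwit (nonempty_finiteQuotientWitness K (index_ne_zero_of_not_le Z hZ K hKZ) hgK)

/-- A homomorphism from a free group lifts along a surjective homomorphism. -/
theorem FreeGroup.exists_comp_eq_of_surjective {α F G : Type*} [Group F] [Group G]
    {φ : F →* G} (hφ : Function.Surjective φ) (ψ : FreeGroup α →* G) :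
    ∃ f : FreeGroup α →* F, φ.comp f = ψ := by
  refine ⟨FreeGroup.lift fun i => Function.surjInv hφ (ψ (FreeGroup.of i)), ?_⟩
  ext i
  simp [Function.surjInv_eq hφ]

/-- Finite presentability does not depend on the finite generating family: the kernel of any
surjection from a finitely generated free group is the normal closure of a finite set. -/
theorem FinitelyPresentedGroup.exists_finite_normalClosure_eq_ker {G : Type*} [Group G]
    (hG : FinitelyPresentedGroup G) {α : Type*} [Finite α] (φ : FreeGroup α →* G)
    (hφ : Function.Surjective φ) :
    ∃ T : Set (FreeGroup α), T.Finite ∧ Subgroup.normalClosure T = φ.ker := by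
  obtain ⟨n, S, hS, ⟨e⟩⟩ := hG
  let ψ : FreeGroup (Fin n) →* G :=
    e.toMonoidHom.comp (QuotientGroup.mk' (Subgroup.normalClosure S))
  have hψ : Function.Surjective ψ := e.surjective.comp (QuotientGroup.mk'_surjective _)
  have hψker (w : FreeGroup (Fin n)) : ψ w = 1 ↔ w ∈ Subgroup.normalClosure S := by simp [ψ]
  obtain ⟨a, ha⟩ := FreeGroup.exists_comp_eq_of_surjective hφ ψ
  obtain ⟨b, hb⟩ := FreeGroup.exists_comp_eq_of_surjective hψ φ
  have ha' (w : FreeGroup (Fin n)) : φ (a w) = ψ w := DFunLike.congr_fun ha w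
  have hb' (w : FreeGroup α) : ψ (b w) = φ w := DFunLike.congr_fun hb w
  refine ⟨a '' S ∪ Set.range fun i => (FreeGroup.of i)⁻¹ * a (b (FreeGroup.of i)),
    (hS.image a).union (Set.finite_range _), le_antisymm ?_ ?_⟩
  · refine Subgroup.normalClosure_le_normal ?_
    rintro _ (⟨s, hs, rfl⟩ | ⟨i, rfl⟩)
    · simpa [MonoidHom.mem_ker, ha', hψker] using Subgroup.subset_normalClosure hs
    · simp [MonoidHom.mem_ker, ha', hb']
  · set M := Subgroup.normalClosure
      (a '' S ∪ Set.range fun i => (FreeGroup.of i)⁻¹ * a (b (FreeGroup.of i)))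
    have hSM : Subgroup.normalClosure S ≤ M.comap a :=
      Subgroup.normalClosure_le_normal fun s hs =>
        Subgroup.subset_normalClosure (Or.inl ⟨s, hs, rfl⟩)
    have hab : QuotientGroup.mk' M = (QuotientGroup.mk' M).comp (a.comp b) := by
      ext i
      exact QuotientGroup.eq.mpr (Subgroup.subset_normalClosure (Or.inr ⟨i, rfl⟩))
    intro x hx
    have hbx : a (b x) ∈ M := hSM ((hψker _).mp ((hb' x).trans hx))
    rw [← QuotientGroup.eq_one_iff] at hbx ⊢
    exact (DFunLike.congr_fun hab x).trans hbx

/-- A finitely presented, finitely discriminable group is isolated. -/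
theorem isolatedGroup_of_finitelyPresented_of_finitelyDiscriminable {G : Type*} [Group G]
    (hfp : FinitelyPresentedGroup G) (hfd : FinitelyDiscriminable G) : IsolatedGroup G := by
  rintro k N _ ⟨e⟩ M hM hin hout
  let φ : FreeGroup (Fin k) →* G := e.toMonoidHom.comp (QuotientGroup.mk' N)
  have hφ : Function.Surjective φ := e.surjective.comp (QuotientGroup.mk'_surjective N)
  have hker : φ.ker = N := by ext; simp [φ]
  obtain ⟨T, hT, hTN⟩ := hfp.exists_finite_normalClosure_eq_ker φ hφ
  obtain ⟨X, hX, hX1, hXmeet⟩ := hfd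
  have hTM : ∀ᶠ n in Filter.atTop, ∀ t ∈ T, t ∈ M n :=
    (Filter.eventually_all_finite hT).mpr fun t ht =>
      hin t (hker ▸ hTN ▸ Subgroup.subset_normalClosure ht)
  have hXM : ∀ᶠ n in Filter.atTop, ∀ x ∈ X, Function.surjInv hφ x ∉ M n := by
    refine (Filter.eventually_all_finite hX).mpr fun x hx => hout _ fun hxN => hX1 ?_
    rw [← hker, MonoidHom.mem_ker, Function.surjInv_eq hφ] at hxN
    exact hxN ▸ hx
  filter_upwards [hTM, hXM] with n hTn hXn
  have hle : φ.ker ≤ M n := by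
    have := hM n
    exact hTN ▸ Subgroup.normalClosure_le_normal hTn
  refine le_antisymm ?_ (hker ▸ hle)
  by_contra hnle
  obtain ⟨x, hx, y, hy, hyx⟩ := hXmeet ((M n).map φ) ((hM n).map φ hφ) (by
    rwa [Ne, Subgroup.map_eq_bot_iff, hker])
  refine hXn x hx ?_
  have hmem : y⁻¹ * Function.surjInv hφ x ∈ M n :=
    hle (by simp [MonoidHom.mem_ker, Function.surjInv_eq hφ, hyx])
  exact ((M n).mul_mem_cancel_left ((M n).inv_mem hy)).mp hmem

/-- If `G` is finitely presented, not residually finite, and has a finite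
normal subgroup `Z` with `G/Z` hereditary just infinite, then `G` is isolated. -/
theorem stmt14 (G : Type*) [Group G] (hfp : FinitelyPresentedGroup G)
    (hnrf : ¬ IsResiduallyFinite G)
    (Z : Subgroup G) [Z.Normal] (hZfin : Finite Z)
    (hhji : HereditaryJustInfinite (G ⧸ Z)) :
    IsolatedGroup G := by
  exact isolatedGroup_of_finitelyPresented_of_finitelyDiscriminable hfp
    (finitelyDiscriminable_of_not_isResiduallyFinite hnrf Z hhji)
end
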